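/- arXiv:1212.5108 — 3 statements merged into one kernel-verified Lean document; each statement's English description precedes it below -/
import Mathlib

section
/- The class of languages of bidimensional context-free hedge automata is not closed under intersection: there exist a finite alphabet Σ and CF²HA A₁ and A₂ over Σ such that no CF²HA over Σ recognizes the hedge language L(A₁) ∩ L(A₂). -/
/-- Unranked trees over alphabet `α`, with variables indexed by `ℕ` at leaves. -/
inductive VTree (α : Type) : Type where
  | var : ℕ → VTree α
  | node : α → List (VTree α) → VTree α

/-- A hedge is a finite sequence of trees. -/
abbrev VHedge (α : Type) := List (VTree α)

/-- Relabeling of trees. -/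
def VTree.map {α β : Type} (f : α → β) : VTree α → VTree β
  | .var x => .var x
  | .node a ts => .node (f a) (ts.attach.map fun t => t.1.map f)
decreasing_by
  have := List.sizeOf_lt_of_mem t.2
  simp only [VTree.node.sizeOf_spec]
  omega

/-- Relabeling of hedges. -/
def hedgeMap {α β : Type} (f : α → β) (h : VHedge α) : VHedge β := h.map (VTree.map f)

/-- A tree is ground if it contains no variable. -/
inductive GroundT {α : Type} : VTree α → Prop where
  | node {a : α} {ts : List (VTree α)} : (∀ t ∈ ts, GroundT t) → GroundT (.node a ts)

/-- A hedge is ground (an element of `H(Σ)`) if all its trees are ground. -/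
def Ground {α : Type} (h : VHedge α) : Prop := ∀ t ∈ h, GroundT t

/-- A bidimensional context-free hedge automaton (CF²HA) over alphabet `S` with
states `Q`. A horizontal transition `p₁(δ₁)…pₙ(δₙ) → q(δ₁…δₙ)` is encoded as a
list of pairs `(pᵢ, bᵢ)` with `pᵢ ∈ S ⊕ Q` and `bᵢ : Bool` telling whether
`δᵢ` is a variable (`true`) or forced to be the empty hedge `ε` (`false`),
together with the target state `q`. A vertical transition `p₁(p₂(δ)) → q(δ)` is
encoded as `(p₁, p₂, b, q)`. Transition sets are finite. -/
structure CF2HA (S Q : Type) where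
  final : Set Q
  hor : Set (List ((S ⊕ Q) × Bool) × Q)
  ver : Set ((S ⊕ Q) × (S ⊕ Q) × Bool × Q)
  hor_fin : hor.Finite
  ver_fin : ver.Finite

/-- The move relation of a CF²HA: the rewrite relation on ground hedges over
`Σ ∪ Q` induced by its transitions (closed under contexts). -/
inductive CF2HA.Step {S Q : Type} (A : CF2HA S Q) :
    VHedge (S ⊕ Q) → VHedge (S ⊕ Q) → Prop where
  | hor {ps : List ((S ⊕ Q) × Bool)} {q : Q} (hs : List (VHedge (S ⊕ Q))) :
      (ps, q) ∈ A.hor → hs.length = ps.length →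
      (∀ pb ∈ List.zip ps hs, pb.1.2 = false → pb.2 = []) →
      CF2HA.Step A (List.zipWith (fun p h => VTree.node p.1 h) ps hs)
        [VTree.node (Sum.inr q) hs.flatten]
  | ver {p₁ p₂ : S ⊕ Q} {b : Bool} {q : Q} (h : VHedge (S ⊕ Q)) :
      (p₁, p₂, b, q) ∈ A.ver → (b = false → h = []) →
      CF2HA.Step A [VTree.node p₁ [VTree.node p₂ h]] [VTree.node (Sum.inr q) h]
  | ctx_hor {h h' : VHedge (S ⊕ Q)} (pre post : VHedge (S ⊕ Q)) :
      CF2HA.Step A h h' → CF2HA.Step A (pre ++ h ++ post) (pre ++ h' ++ post)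
  | ctx_ver {h h' : VHedge (S ⊕ Q)} (a : S ⊕ Q) :
      CF2HA.Step A h h' → CF2HA.Step A [VTree.node a h] [VTree.node a h']

/-- `L(A, q)`: ground hedges over `S` that reduce to `q(ε)`. -/
def CF2HA.stateLang {S Q : Type} (A : CF2HA S Q) (q : Q) : Set (VHedge S) :=
  { h | Ground h ∧
    Relation.ReflTransGen A.Step (hedgeMap Sum.inl h) [VTree.node (Sum.inr q) []] }

/-- `L(A)`: hedges accepted in some final state. -/
def CF2HA.lang {S Q : Type} (A : CF2HA S Q) : Set (VHedge S) :=
  { h | ∃ q ∈ A.final, h ∈ A.stateLang q }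


open Relation

/-- One reduction step of words: a factor matching the left side of a rule is replaced by its
target letter. -/
inductive WordStep {V : Type} (R : Set (List V × V)) : List V → List V → Prop where
  | mk {r : List V} {t : V} (x z : List V) : (r, t) ∈ R →
      WordStep R (x ++ r ++ z) (x ++ [t] ++ z)

section WordReduction

variable {V : Type} {R : Set (List V × V)}

theorem WordStep.append {u v : List V} (h : WordStep R u v) (x z : List V) :
    WordStep R (x ++ u ++ z) (x ++ v ++ z) := by
  obtain ⟨x', z', hr⟩ := h
  simpa using WordStep.mk (x ++ x') (z' ++ z) hr

theorem wordSteps_append {u v : List V} (h : ReflTransGen (WordStep R) u v) (x z : List V) :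
    ReflTransGen (WordStep R) (x ++ u ++ z) (x ++ v ++ z) :=
  h.lift (fun w => x ++ w ++ z) fun _ _ hs => hs.append x z

theorem wordSteps_flatten {bs : List (V × List V)}
    (h : ∀ b ∈ bs, ReflTransGen (WordStep R) b.2 [b.1]) :
    ReflTransGen (WordStep R) (bs.map Prod.snd).flatten (bs.map Prod.fst) := by
  induction bs with
  | nil => exact .refl
  | cons b bs ih =>
    have h₁ := wordSteps_append (h b (by simp)) [] (bs.map Prod.snd).flatten
    have h₂ := wordSteps_append (ih fun c hc => h c (by simp [hc])) [b.1] []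
    simp only [List.nil_append, List.append_nil] at h₁ h₂
    simpa using h₁.trans h₂

theorem length_flatten_le {bs : List (V × List V)} {m : ℕ} (h : ∀ b ∈ bs, b.2.length ≤ m) :
    (bs.map Prod.snd).flatten.length ≤ bs.length * m := by
  induction bs with
  | nil => simp
  | cons b bs ih =>
    have h₁ := h b (by simp)
    have h₂ := ih fun c hc => h c (by simp [hc])
    simp only [List.map_cons, List.flatten_cons, List.length_append, List.length_cons]
    linarith

/-- If `w` is cut into blocks of length at most `m`, each reducing to one letter, and the word of
these letters reduces to `q`, then some factor of length in `(m, k * m]` reduces to one letter in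
a reduction of `w`. -/
theorem exists_factor_of_blocks {k m : ℕ} (hk : ∀ r t, (r, t) ∈ R → r.length ≤ k) {q : V}
    {u : List V} (hu : ReflTransGen (WordStep R) u [q]) :
    ∀ bs : List (V × List V), bs.map Prod.fst = u →
      (∀ b ∈ bs, ReflTransGen (WordStep R) b.2 [b.1]) → (∀ b ∈ bs, b.2.length ≤ m) →
      m < (bs.map Prod.snd).flatten.length →
      ∃ x v z t, (bs.map Prod.snd).flatten = x ++ v ++ z ∧
        ReflTransGen (WordStep R) v [t] ∧ ReflTransGen (WordStep R) (x ++ [t] ++ z) [q] ∧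
        m < v.length ∧ v.length ≤ k * m := by
  induction hu using ReflTransGen.head_induction_on with
  | refl =>
    intro bs hbs _ hm hlt
    have h₁ := length_flatten_le hm
    have h₂ : bs.length = 1 := by simpa using congrArg List.length hbs
    rw [h₂] at h₁
    omega
  | head hstep hrest ih =>
    intro bs hbs hred hm hlt
    obtain ⟨x, z, hr⟩ := hstep
    rename_i r t
    obtain ⟨bxr, bz, rfl, hxr, hz⟩ := List.map_eq_append_iff.1 hbs
    obtain ⟨bx, br, rfl, hx, hr'⟩ := List.map_eq_append_iff.1 hxr
    have hv : ReflTransGen (WordStep R) (br.map Prod.snd).flatten [t] := by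
      refine (wordSteps_flatten fun b hb => hred b (by simp [hb])).tail ?_
      rw [hr']
      simpa using WordStep.mk [] [] hr
    by_cases hle : (br.map Prod.snd).flatten.length ≤ m
    · have key := ih (bx ++ [(t, (br.map Prod.snd).flatten)] ++ bz) (by simp [hx, hz])
        (by
          intro b hb
          simp only [List.mem_append, List.mem_singleton] at hb
          rcases hb with (hb | rfl) | hb
          · exact hred b (by simp [hb])
          · exact hv
          · exact hred b (by simp [hb]))
        (by
          intro b hb
          simp only [List.mem_append, List.mem_singleton] at hb
          rcases hb with (hb | rfl) | hb
          · exact hm b (by simp [hb])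
          · exact hle
          · exact hm b (by simp [hb]))
        (by simpa using hlt)
      simpa using key
    · refine ⟨(bx.map Prod.snd).flatten, (br.map Prod.snd).flatten, (bz.map Prod.snd).flatten, t,
        by simp, hv, ?_, by omega, ?_⟩
      · have h₁ := wordSteps_append
          (wordSteps_flatten (R := R) (bs := bx) fun b hb => hred b (by simp [hb])) []
          ([t] ++ (bz.map Prod.snd).flatten)
        have h₂ := wordSteps_append
          (wordSteps_flatten (R := R) (bs := bz) fun b hb => hred b (by simp [hb]))
          (x ++ [t]) []
        rw [hx] at h₁
        rw [hz] at h₂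
        simp only [List.nil_append, List.append_nil, List.append_assoc] at h₁ h₂ hrest ⊢
        exact (h₁.trans h₂).trans hrest
      · refine (length_flatten_le fun b hb => hm b (by simp [hb])).trans
          (Nat.mul_le_mul_right m ?_)
        have := congrArg List.length hr'
        rw [List.length_map] at this
        rw [this]
        exact hk r t hr

/-- A word reducing to a letter has factors of every order of magnitude reducing to a letter. -/
theorem exists_factor {k m : ℕ} (hk : ∀ r t, (r, t) ∈ R → r.length ≤ k) (hm : 1 ≤ m) {q : V}
    {w : List V} (hw : ReflTransGen (WordStep R) w [q]) (hlt : m < w.length) :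
    ∃ x v z t, w = x ++ v ++ z ∧
      ReflTransGen (WordStep R) v [t] ∧ ReflTransGen (WordStep R) (x ++ [t] ++ z) [q] ∧
      m < v.length ∧ v.length ≤ k * m := by
  have hflat : ((w.map fun a => (a, [a])).map Prod.snd).flatten = w := by
    simp [Function.comp_def, ← List.flatMap_def]
  have key := exists_factor_of_blocks (m := m) hk hw (w.map fun a => (a, [a]))
    (by simp [Function.comp_def])
    (by
      intro b hb
      obtain ⟨a, -, rfl⟩ := List.mem_map.1 hb
      exact .refl)
    (by
      intro b hb
      obtain ⟨a, -, rfl⟩ := List.mem_map.1 hb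
      simpa using hm)
    (by rwa [hflat])
  rwa [hflat] at key

theorem sum_map_eq_of_wordSteps (f : V → ℤ) (hf : ∀ r t, (r, t) ∈ R → (r.map f).sum = f t)
    {u v : List V} (h : ReflTransGen (WordStep R) u v) : (u.map f).sum = (v.map f).sum := by
  induction h with
  | refl => rfl
  | tail _ hs ih =>
    obtain ⟨x, z, hr⟩ := hs
    rw [ih]
    simp [hf _ _ hr]

end WordReduction

/-- The one-node tree labelled `a`. -/
def leaf {α : Type} (a : α) : VTree α := .node a []

/-- The tree has no variable and all its labels satisfy `P`. -/
inductive AllLabels {α : Type} (P : α → Prop) : VTree α → Prop where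
  | node {a : α} {ts : List (VTree α)} : P a → (∀ t ∈ ts, AllLabels P t) →
      AllLabels P (.node a ts)

/-- The tree is not a variable and all labels strictly below its root satisfy `P`. -/
inductive BelowLabels {α : Type} (P : α → Prop) : VTree α → Prop where
  | node {a : α} {ts : List (VTree α)} : (∀ t ∈ ts, AllLabels P t) →
      BelowLabels P (.node a ts)

theorem allLabels_node {α : Type} {P : α → Prop} {a : α} {ts : List (VTree α)} :
    AllLabels P (.node a ts) ↔ P a ∧ ∀ t ∈ ts, AllLabels P t :=
  ⟨fun | .node h₁ h₂ => ⟨h₁, h₂⟩, fun h => .node h.1 h.2⟩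

theorem belowLabels_node {α : Type} {P : α → Prop} {a : α} {ts : List (VTree α)} :
    BelowLabels P (.node a ts) ↔ ∀ t ∈ ts, AllLabels P t :=
  ⟨fun | .node h => h, .node⟩

/-- The root label of a tree, if any. -/
def VTree.root? {α : Type} : VTree α → Option α
  | .var _ => none
  | .node a _ => some a

/-- The word of root labels of a hedge. -/
def rootWord {α : Type} (h : VHedge α) : List α := h.filterMap VTree.root?

theorem rootWord_singleton {α : Type} (a : α) (ts : List (VTree α)) :
    rootWord [VTree.node a ts] = [a] := rfl

theorem rootWord_map_leaf {α : Type} (w : List α) : rootWord (w.map leaf) = w := by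
  induction w with
  | nil => rfl
  | cons a w ih => simpa [rootWord, leaf, VTree.root?] using ih

theorem hedgeMap_map_leaf {α β : Type} (f : α → β) (w : List α) :
    hedgeMap f (w.map leaf) = (w.map f).map leaf := by
  simp [hedgeMap, leaf, VTree.map, Function.comp_def]

theorem ground_map_leaf {α : Type} (w : List α) : Ground (w.map leaf) := by
  intro t ht
  obtain ⟨a, -, rfl⟩ := List.mem_map.1 ht
  exact .node (by simp)

theorem rootWord_zipWith {α : Type} : ∀ (ps : List (α × Bool)) (hs : List (VHedge α)),
    hs.length = ps.length →
    rootWord (List.zipWith (fun p h => VTree.node p.1 h) ps hs) = ps.map Prod.fst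
  | [], _, _ => by simp [rootWord]
  | p :: ps, [], h => by simp at h
  | p :: ps, h :: hs, hl => by
    have := rootWord_zipWith ps hs (by simpa using hl)
    simpa [rootWord, VTree.root?] using this

theorem allLabels_zipWith {α : Type} {P : α → Prop} :
    ∀ (ps : List (α × Bool)) (hs : List (VHedge α)), hs.length = ps.length →
    (∀ t ∈ List.zipWith (fun p h => VTree.node p.1 h) ps hs, AllLabels P t) →
    (∀ a ∈ ps.map Prod.fst, P a) ∧ ∀ t ∈ hs.flatten, AllLabels P t
  | [], [], _, _ => by simp
  | [], _ :: _, hl, _ => by simp at hl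
  | p :: ps, [], hl, _ => by simp at hl
  | p :: ps, h :: hs, hl, H => by
    simp only [List.zipWith_cons_cons, List.forall_mem_cons, allLabels_node] at H
    obtain ⟨h₁, h₂⟩ := allLabels_zipWith ps hs (by simpa using hl) H.2
    simp only [List.map_cons, List.flatten_cons, List.forall_mem_cons, List.forall_mem_append]
    exact ⟨⟨H.1.1, h₁⟩, H.1.2, h₂⟩

theorem belowLabels_zipWith {α : Type} {P : α → Prop} :
    ∀ (ps : List (α × Bool)) (hs : List (VHedge α)), hs.length = ps.length →
    (∀ t ∈ List.zipWith (fun p h => VTree.node p.1 h) ps hs, BelowLabels P t) →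
    ∀ t ∈ hs.flatten, AllLabels P t
  | _, [], _, _ => by simp
  | [], _ :: _, hl, _ => by simp at hl
  | p :: ps, h :: hs, hl, H => by
    simp only [List.zipWith_cons_cons, List.forall_mem_cons, belowLabels_node] at H
    have h₂ := belowLabels_zipWith ps hs (by simpa using hl) H.2
    simp only [List.flatten_cons, List.forall_mem_append]
    exact ⟨H.1, h₂⟩

namespace CF2HA

variable {S Q : Type} (A : CF2HA S Q)

/-- Labels `p` such that the leaf `p` can be produced from the empty hedge. -/
def Nullable (p : S ⊕ Q) : Prop := ReflTransGen A.Step [] [leaf p]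

/-- The word rules simulating the automaton on flat hedges: horizontal transitions, and vertical
transitions whose lower label is nullable. -/
def wordRules : Set (List (S ⊕ Q) × (S ⊕ Q)) :=
  { rt | (∃ ps q, (ps, q) ∈ A.hor ∧ rt = (ps.map Prod.fst, Sum.inr q)) ∨
    ∃ p₁ p₂ b q, (p₁, p₂, b, q) ∈ A.ver ∧ A.Nullable p₂ ∧ rt = ([p₁], Sum.inr q) }

variable {A}

theorem steps_append {h h' : VHedge (S ⊕ Q)} (H : ReflTransGen A.Step h h')
    (pre post : VHedge (S ⊕ Q)) :
    ReflTransGen A.Step (pre ++ h ++ post) (pre ++ h' ++ post) :=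
  H.lift (fun w => pre ++ w ++ post) fun _ _ hs => .ctx_hor pre post hs

theorem steps_of_wordRules {r : List (S ⊕ Q)} {t : S ⊕ Q} (h : (r, t) ∈ A.wordRules) :
    ReflTransGen A.Step (r.map leaf) [leaf t] := by
  rcases h with ⟨ps, q, hq, he⟩ | ⟨p₁, p₂, b, q, hq, hn, he⟩
  · obtain ⟨rfl, rfl⟩ := Prod.mk.inj he
    have hstep := CF2HA.Step.hor (ps.map fun _ => []) hq (by simp) (by
      rintro ⟨p, h⟩ hp -
      have := (List.of_mem_zip hp).2
      simp only [List.mem_map] at this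
      obtain ⟨_, _, rfl⟩ := this
      rfl)
    have h₁ : ∀ ps : List ((S ⊕ Q) × Bool),
        List.zipWith (fun p h => VTree.node p.1 h) ps (ps.map fun _ => []) =
          (ps.map Prod.fst).map leaf := by
      intro ps
      induction ps with
      | nil => rfl
      | cons p ps ih => simpa [leaf] using ih
    have h₂ : (ps.map fun _ => ([] : VHedge (S ⊕ Q))).flatten = [] := by simp
    rw [h₁, h₂] at hstep
    exact .single hstep
  · obtain ⟨rfl, rfl⟩ := Prod.mk.inj he
    have h₁ : ReflTransGen A.Step [VTree.node p₁ []] [VTree.node p₁ [leaf p₂]] :=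
      ReflTransGen.lift (fun w : VHedge (S ⊕ Q) => [VTree.node p₁ w])
        (fun _ _ hs => CF2HA.Step.ctx_ver p₁ hs) _ _ hn
    exact h₁.tail (.ver [] hq fun _ => rfl)

theorem steps_of_wordSteps {u v : List (S ⊕ Q)}
    (h : ReflTransGen (WordStep A.wordRules) u v) :
    ReflTransGen A.Step (u.map leaf) (v.map leaf) := by
  induction h with
  | refl => exact .refl
  | tail _ hs ih =>
    obtain ⟨x, z, hr⟩ := hs
    refine ih.trans ?_
    simpa using steps_append (steps_of_wordRules hr) (x.map leaf) (z.map leaf)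

theorem nullable_of_wordRules {r : List (S ⊕ Q)} {t : S ⊕ Q} (h : (r, t) ∈ A.wordRules)
    (hr : ∀ p ∈ r, A.Nullable p) : A.Nullable t := by
  refine ReflTransGen.trans ?_ (steps_of_wordRules h)
  clear h
  induction r with
  | nil => exact .refl
  | cons p r ih =>
    have h₁ : ReflTransGen A.Step [] [leaf p] := hr p (by simp)
    have h₂ := steps_append (ih fun a ha => hr a (by simp [ha])) [leaf p] []
    simp only [List.append_nil] at h₂
    exact h₁.trans h₂

theorem allLabels_of_step {h h' : VHedge (S ⊕ Q)} (H : A.Step h h')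
    (hall : ∀ t ∈ h, AllLabels A.Nullable t) : ∀ t ∈ h', AllLabels A.Nullable t := by
  induction H with
  | hor hs hq hl _ =>
    obtain ⟨h₁, h₂⟩ := allLabels_zipWith _ hs hl hall
    simp only [List.forall_mem_singleton, allLabels_node]
    exact ⟨nullable_of_wordRules (.inl ⟨_, _, hq, rfl⟩) h₁, h₂⟩
  | ver h hq _ =>
    simp only [List.forall_mem_singleton, allLabels_node] at hall ⊢
    obtain ⟨h₁, h₂, h₃⟩ := hall
    exact ⟨nullable_of_wordRules (.inr ⟨_, _, _, _, hq, h₂, rfl⟩) (by simpa using h₁), h₃⟩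
  | ctx_hor pre post _ ih =>
    simp only [List.forall_mem_append] at hall ⊢
    exact ⟨⟨hall.1.1, ih hall.1.2⟩, hall.2⟩
  | ctx_ver a _ ih =>
    simp only [List.forall_mem_singleton, allLabels_node] at hall ⊢
    exact ⟨hall.1, ih hall.2⟩

/-- On hedges whose inner labels are all nullable, a move only changes the word of root labels
by word reductions. -/
theorem wordSteps_of_step {h h' : VHedge (S ⊕ Q)} (H : A.Step h h')
    (hb : ∀ t ∈ h, BelowLabels A.Nullable t) :
    (∀ t ∈ h', BelowLabels A.Nullable t) ∧
      ReflTransGen (WordStep A.wordRules) (rootWord h) (rootWord h') := by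
  induction H with
  | hor hs hq hl _ =>
    refine ⟨by simpa only [List.forall_mem_singleton, belowLabels_node] using
      belowLabels_zipWith _ hs hl hb, .single ?_⟩
    rw [rootWord_zipWith _ _ hl, rootWord_singleton]
    simpa using WordStep.mk [] [] (Or.inl ⟨_, _, hq, rfl⟩ : _ ∈ A.wordRules)
  | ver h hq _ =>
    simp only [List.forall_mem_singleton, belowLabels_node, allLabels_node] at hb ⊢
    exact ⟨hb.2, .single (by
      simpa [rootWord_singleton] using
        WordStep.mk [] [] (Or.inr ⟨_, _, _, _, hq, hb.1, rfl⟩ : _ ∈ A.wordRules))⟩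
  | ctx_hor pre post _ ih =>
    simp only [List.forall_mem_append] at hb ⊢
    obtain ⟨h₁, h₂⟩ := ih hb.1.2
    refine ⟨⟨⟨hb.1.1, h₁⟩, hb.2⟩, ?_⟩
    simpa [rootWord] using wordSteps_append h₂ (rootWord pre) (rootWord post)
  | ctx_ver a hs _ =>
    simp only [List.forall_mem_singleton, belowLabels_node] at hb ⊢
    exact ⟨allLabels_of_step hs hb, .refl⟩

theorem wordSteps_of_steps {u : List (S ⊕ Q)} {h : VHedge (S ⊕ Q)}
    (H : ReflTransGen A.Step (u.map leaf) h) :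
    (∀ t ∈ h, BelowLabels A.Nullable t) ∧
      ReflTransGen (WordStep A.wordRules) u (rootWord h) := by
  induction H with
  | refl =>
    refine ⟨fun t ht => ?_, by rw [rootWord_map_leaf]⟩
    obtain ⟨a, -, rfl⟩ := List.mem_map.1 ht
    exact .node (by simp)
  | tail _ hs ih =>
    obtain ⟨h₁, h₂⟩ := wordSteps_of_step hs ih.1
    exact ⟨h₁, ih.2.trans h₂⟩

/-- Acceptance of flat hedges is reducibility of words. -/
theorem map_leaf_mem_lang {w : List S} :
    w.map leaf ∈ A.lang ↔ ∃ q ∈ A.final,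
      ReflTransGen (WordStep A.wordRules) (w.map Sum.inl) [Sum.inr q] := by
  simp only [lang, stateLang, Set.mem_ofPred_eq, hedgeMap_map_leaf]
  refine exists_congr fun q => and_congr_right fun _ => ⟨fun h => ?_, fun h => ?_⟩
  · simpa [rootWord, VTree.root?] using (wordSteps_of_steps h.2).2
  · exact ⟨ground_map_leaf w, by simpa [leaf] using steps_of_wordSteps h⟩

theorem exists_wordRules_length_le (A : CF2HA S Q) :
    ∃ k, 1 ≤ k ∧ ∀ r t, (r, t) ∈ A.wordRules → r.length ≤ k := by
  obtain ⟨k, hk⟩ := (A.hor_fin.image fun pq => pq.1.length).bddAbove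
  refine ⟨k + 1, by omega, ?_⟩
  rintro r t (⟨ps, q, hq, he⟩ | ⟨p₁, p₂, b, q, -, -, he⟩)
  · obtain ⟨rfl, rfl⟩ := Prod.mk.inj he
    have := hk ⟨_, hq, rfl⟩
    simp only [List.length_map] at this ⊢
    omega
  · obtain ⟨rfl, rfl⟩ := Prod.mk.inj he
    simp

end CF2HA

/-- An automaton on flat words: as many letters `x` as letters `y`, nested, padded by letters `z`
on either side. -/
def matchingAut (x y z : Fin 3) : CF2HA (Fin 3) Unit where
  final := Set.univ
  hor := {([(.inl x, false), (.inl y, false)], ()),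
    ([(.inl x, false), (.inr (), false), (.inl y, false)], ()),
    ([(.inr (), false), (.inl z, false)], ()),
    ([(.inl z, false), (.inr (), false)], ())}
  ver := ∅
  hor_fin := by simp
  ver_fin := Set.finite_empty

theorem mem_wordRules_matchingAut {x y z : Fin 3} {r : List (Fin 3 ⊕ Unit)} {t : Fin 3 ⊕ Unit} :
    (r, t) ∈ (matchingAut x y z).wordRules ↔ t = .inr () ∧
      (r = [.inl x, .inl y] ∨ r = [.inl x, .inr (), .inl y] ∨ r = [.inr (), .inl z] ∨
        r = [.inl z, .inr ()]) := by
  simp only [CF2HA.wordRules, matchingAut, Set.mem_ofPred_eq, Set.mem_insert_iff,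
    Set.mem_singleton_iff, Set.mem_empty_iff_false, false_and, exists_const, or_false,
    Prod.mk.injEq]
  constructor
  · rintro ⟨ps, q, h, rfl, rfl⟩
    rcases h with ⟨rfl, -⟩ | ⟨rfl, -⟩ | ⟨rfl, -⟩ | ⟨rfl, -⟩ <;> simp
  · rintro ⟨rfl, h⟩
    rcases h with rfl | rfl | rfl | rfl
    · exact ⟨_, (), .inl ⟨rfl, trivial⟩, rfl, rfl⟩
    · exact ⟨_, (), .inr (.inl ⟨rfl, trivial⟩), rfl, rfl⟩
    · exact ⟨_, (), .inr (.inr (.inl ⟨rfl, trivial⟩)), rfl, rfl⟩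
    · exact ⟨_, (), .inr (.inr (.inr ⟨rfl, trivial⟩)), rfl, rfl⟩

theorem sum_map_ite_sub {α : Type} [DecidableEq α] (x y : α) (w : List α) :
    (w.map fun s => (if s = x then (1 : ℤ) else 0) - if s = y then 1 else 0).sum =
      (w.count x : ℤ) - w.count y := by
  induction w with
  | nil => simp
  | cons a w ih =>
    rw [List.map_cons, List.sum_cons, ih]
    simp only [List.count_cons, beq_iff_eq]
    push_cast
    ring

theorem count_eq_of_mem_matchingAut {x y z : Fin 3} (hxy : x ≠ y) (hzx : z ≠ x) (hzy : z ≠ y)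
    {w : List (Fin 3)} (h : w.map leaf ∈ (matchingAut x y z).lang) : w.count x = w.count y := by
  obtain ⟨q, -, hq⟩ := CF2HA.map_leaf_mem_lang.1 h
  have key := sum_map_eq_of_wordSteps
    (Sum.elim (fun s => (if s = x then (1 : ℤ) else 0) - if s = y then 1 else 0) fun _ => 0)
    (by
      intro r t hr
      obtain ⟨rfl, rfl | rfl | rfl | rfl⟩ := mem_wordRules_matchingAut.1 hr <;>
        simp [hxy, hxy.symm, hzx, hzy]) hq
  rw [List.map_map, Sum.elim_comp_inl, sum_map_ite_sub] at key
  simp only [List.map_cons, Sum.elim_inr, List.map_nil, List.sum_cons, List.sum_nil] at key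
  omega

section MatchingReductions

variable (x y z : Fin 3)

theorem wordSteps_matchingAut_nested (n : ℕ) :
    ReflTransGen (WordStep (matchingAut x y z).wordRules)
      (List.replicate (n + 1) (.inl x) ++ List.replicate (n + 1) (.inl y)) [.inr ()] := by
  induction n with
  | zero =>
    exact .single (by
      simpa using WordStep.mk [] [] (mem_wordRules_matchingAut.2 ⟨rfl, .inl rfl⟩))
  | succ n ih =>
    have h := (wordSteps_append ih [.inl x] [.inl y]).tail (by
      simpa using WordStep.mk [] [] (mem_wordRules_matchingAut.2 ⟨rfl, .inr (.inl rfl)⟩))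
    rw [List.replicate_succ, List.replicate_succ' (n := n + 1) (a := Sum.inl y)]
    simpa using h

theorem wordSteps_matchingAut_right (n : ℕ) :
    ReflTransGen (WordStep (matchingAut x y z).wordRules)
      ([.inr ()] ++ List.replicate n (.inl z)) [.inr ()] := by
  induction n with
  | zero => exact .refl
  | succ n ih =>
    refine .head ?_ ih
    simpa [List.replicate_succ] using WordStep.mk [] (List.replicate n (.inl z))
      (mem_wordRules_matchingAut.2 ⟨rfl, .inr (.inr (.inl rfl))⟩ :
        _ ∈ (matchingAut x y z).wordRules)

theorem wordSteps_matchingAut_left (n : ℕ) :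
    ReflTransGen (WordStep (matchingAut x y z).wordRules)
      (List.replicate n (.inl z) ++ [.inr ()]) [.inr ()] := by
  induction n with
  | zero => exact .refl
  | succ n ih =>
    refine .head ?_ ih
    simpa [List.replicate_succ'] using WordStep.mk (List.replicate n (.inl z)) []
      (mem_wordRules_matchingAut.2 ⟨rfl, .inr (.inr (.inr rfl))⟩ :
        _ ∈ (matchingAut x y z).wordRules)

end MatchingReductions

/-- The word `0ⁿ1ⁿ2ⁿ`. -/
def threeBlocks (n : ℕ) : List (Fin 3) :=
  List.replicate n 0 ++ List.replicate n 1 ++ List.replicate n 2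

theorem threeBlocks_mem_lang {n : ℕ} (hn : 1 ≤ n) :
    (threeBlocks n).map leaf ∈ (matchingAut 0 1 2).lang ∩ (matchingAut 1 2 0).lang := by
  obtain ⟨n, rfl⟩ := Nat.exists_eq_add_of_le' hn
  refine ⟨CF2HA.map_leaf_mem_lang.2 ⟨(), trivial, ?_⟩,
    CF2HA.map_leaf_mem_lang.2 ⟨(), trivial, ?_⟩⟩
  · have h := wordSteps_append (wordSteps_matchingAut_nested 0 1 2 n) []
      (List.replicate (n + 1) (.inl 2))
    rw [List.nil_append] at h
    simpa only [threeBlocks, List.map_append, List.map_replicate] using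
      h.trans (wordSteps_matchingAut_right 0 1 2 (n + 1))
  · have h := wordSteps_append (wordSteps_matchingAut_nested 1 2 0 n)
      (List.replicate (n + 1) (.inl 0)) []
    simp only [List.append_nil] at h
    simpa only [threeBlocks, List.map_append, List.map_replicate, List.append_assoc] using
      h.trans (wordSteps_matchingAut_left 1 2 0 (n + 1))

theorem count_threeBlocks (n : ℕ) (s : Fin 3) : (threeBlocks n).count s = n := by
  fin_cases s <;> simp [threeBlocks, List.count_replicate]

theorem length_eq_sum_count (w : List (Fin 3)) :
    w.length = w.count 0 + w.count 1 + w.count 2 := by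
  induction w with
  | nil => rfl
  | cons a w ih =>
    fin_cases a <;> simp [ih] <;> omega

/-- A factor of `0ⁿ1ⁿ2ⁿ` of length at most `n` misses a letter. -/
theorem exists_count_eq_zero_of_threeBlocks {n : ℕ} {x v z : List (Fin 3)}
    (h : threeBlocks n = x ++ v ++ z) (hv : v.length ≤ n) : ∃ s : Fin 3, v.count s = 0 := by
  rcases le_or_gt n x.length with hx | hx
  · refine ⟨0, List.count_eq_zero.2 fun hmem => ?_⟩
    have h₁ := congrArg (List.drop n) h
    rw [List.append_assoc x, List.drop_append_of_le_length hx, threeBlocks, List.append_assoc,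
      List.drop_left' (by simp)] at h₁
    have h₂ : (0 : Fin 3) ∈ List.drop n x ++ (v ++ z) := by simp [hmem]
    rw [← h₁] at h₂
    simp [List.mem_replicate] at h₂
  · refine ⟨2, List.count_eq_zero.2 fun hmem => ?_⟩
    have h₁ := congrArg (List.take (n + n)) h
    rw [threeBlocks, List.take_left' (by simp), List.take_append,
      List.take_of_length_le (by rw [List.length_append]; omega)] at h₁
    have h₂ : (2 : Fin 3) ∈ x ++ v ++ List.take (n + n - (x ++ v).length) z := by simp [hmem]
    rw [← h₁] at h₂
    simp [List.mem_replicate] at h₂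

/-- The class of CF²HA languages is not closed under intersection. -/
theorem cf2ha_not_closed_under_intersection :
    ∃ (S : Type) (_ : Finite S)
      (Q₁ : Type) (_ : Finite Q₁) (A₁ : CF2HA S Q₁)
      (Q₂ : Type) (_ : Finite Q₂) (A₂ : CF2HA S Q₂),
      ∀ (Q : Type) (_ : Finite Q) (A : CF2HA S Q),
        A.lang ≠ A₁.lang ∩ A₂.lang := by
  refine ⟨Fin 3, inferInstance, Unit, inferInstance, matchingAut 0 1 2, Unit, inferInstance,
    matchingAut 1 2 0, fun Q _ A hA => ?_⟩
  obtain ⟨k, hk1, hk⟩ := A.exists_wordRules_length_le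
  have hcount : ∀ w : List (Fin 3), w.map leaf ∈ A.lang →
      w.count 0 = w.count 1 ∧ w.count 1 = w.count 2 := fun w hw => by
    rw [hA] at hw
    exact ⟨count_eq_of_mem_matchingAut (by decide) (by decide) (by decide) hw.1,
      count_eq_of_mem_matchingAut (by decide) (by decide) (by decide) hw.2⟩
  have factor : ∀ m : ℕ, ∃ c : (Fin 3 ⊕ Q) × Fin 3, ∃ x v z : List (Fin 3), ∃ q ∈ A.final,
      threeBlocks (k * (m + 1)) = x ++ v ++ z ∧
      ReflTransGen (WordStep A.wordRules) (v.map Sum.inl) [c.1] ∧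
      ReflTransGen (WordStep A.wordRules) (x.map Sum.inl ++ [c.1] ++ z.map Sum.inl)
        [Sum.inr q] ∧
      m < v.length ∧ v.length ≤ k * (m + 1) ∧ v.count c.2 = 0 := by
    intro m
    have hN : m + 1 ≤ k * (m + 1) := Nat.le_mul_of_pos_left _ hk1
    have hmem : (threeBlocks (k * (m + 1))).map leaf ∈ A.lang := by
      rw [hA]
      exact threeBlocks_mem_lang (by omega)
    obtain ⟨q, hqf, hq⟩ := CF2HA.map_leaf_mem_lang.1 hmem
    obtain ⟨x', v', z', t, he, hv, hxz, h₁, h₂⟩ := exists_factor (m := m + 1) hk (by omega) hq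
      (by simp [threeBlocks]; omega)
    obtain ⟨xv, z, he', hxv, rfl⟩ := List.map_eq_append_iff.1 he
    obtain ⟨x, v, rfl, rfl, rfl⟩ := List.map_eq_append_iff.1 hxv
    rw [List.length_map] at h₁ h₂
    obtain ⟨s, hs⟩ := exists_count_eq_zero_of_threeBlocks he' h₂
    exact ⟨(t, s), x, v, z, q, hqf, he', hv, hxz, by omega, h₂, hs⟩
  choose c hc using factor
  obtain ⟨c₀, hinf⟩ := Finite.exists_infinite_fiber c
  have hinf' : (c ⁻¹' {c₀}).Infinite := Set.infinite_coe_iff.1 hinf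
  obtain ⟨m, hm⟩ := hinf'.nonempty
  obtain ⟨m', hm', hlt⟩ := hinf'.exists_gt (k * (m + 1))
  obtain ⟨x, v, z, q, hqf, he, -, hxz, -, hle, hs⟩ := hc m
  obtain ⟨-, v', -, -, -, -, hv', -, hlt', -, hs'⟩ := hc m'
  rw [Set.mem_preimage, Set.mem_singleton_iff] at hm hm'
  rw [hm] at hxz hs
  rw [hm'] at hv' hs'
  have hmem : (x ++ v' ++ z).map leaf ∈ A.lang :=
    CF2HA.map_leaf_mem_lang.2 ⟨q, hqf, by
      simpa using (wordSteps_append hv' (x.map Sum.inl) (z.map Sum.inl)).trans hxz⟩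
  obtain ⟨h₁, h₂⟩ := hcount _ hmem
  have hcs : (x ++ v' ++ z).count c₀.2 = k * (m + 1) := by
    rw [← count_threeBlocks (k * (m + 1)) c₀.2, he]
    simp [hs, hs']
  have hall : ∀ s : Fin 3, (x ++ v' ++ z).count s = (x ++ v' ++ z).count 0 := by
    intro s
    fin_cases s
    · rfl
    · exact h₁.symm
    · exact (h₁.trans h₂).symm
  have hlen' := length_eq_sum_count (x ++ v' ++ z)
  have hlen := length_eq_sum_count (x ++ v ++ z)
  rw [hall 1, hall 2, ← hall c₀.2, hcs] at hlen'
  rw [← he, count_threeBlocks, count_threeBlocks, count_threeBlocks, he] at hlen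
  simp only [List.length_append] at hlen hlen'
  omega
end

section
/- Every context-free hedge automaton language is a bidimensional context-free hedge automaton language: for every CFHA B over a finite alphabet Σ there exists a CF²HA A over Σ with L(A) = L(B); moreover A can be taken with only variable-free transitions of the forms p₁…pₙ → q and a(q₁) → q₂ with a ∈ Σ and q₁, q₂ states. -/
/-- A hedge automaton in the sense of transitions `a(L) → q`, where `L ⊆ Q*` is
a word language. With all `L` regular this is a hedge automaton (HA), with all
`L` context-free it is a context-free hedge automaton (CFHA). -/
structure WordHA (S Q : Type) where
  final : Set Q
  trans : Set (S × Language Q × Q)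
  trans_fin : trans.Finite

/-- All horizontal languages are regular: a hedge automaton. -/
def WordHA.IsHA {S Q : Type} (B : WordHA S Q) : Prop :=
  ∀ t ∈ B.trans, (t.2.1 : Language Q).IsRegular

/-- All horizontal languages are context-free: a context-free hedge automaton. -/
def WordHA.IsCFHA {S Q : Type} (B : WordHA S Q) : Prop :=
  ∀ t ∈ B.trans, (t.2.1 : Language Q).IsContextFree

/-- The move relation: rewrite relation on ground hedges over `Σ ∪ Q` induced
by the transitions `a(L) → q`. -/
inductive WordHA.Step {S Q : Type} (B : WordHA S Q) :
    VHedge (S ⊕ Q) → VHedge (S ⊕ Q) → Prop where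
  | trans {a : S} {L : Language Q} {q : Q} {w : List Q} :
      (a, L, q) ∈ B.trans → w ∈ L →
      WordHA.Step B
        [VTree.node (Sum.inl a) (w.map fun p => VTree.node (Sum.inr p) [])]
        [VTree.node (Sum.inr q) []]
  | ctx_hor {h h' : VHedge (S ⊕ Q)} (pre post : VHedge (S ⊕ Q)) :
      WordHA.Step B h h' → WordHA.Step B (pre ++ h ++ post) (pre ++ h' ++ post)
  | ctx_ver {h h' : VHedge (S ⊕ Q)} (a : S ⊕ Q) :
      WordHA.Step B h h' → WordHA.Step B [VTree.node a h] [VTree.node a h']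

/-- `L(B, q)`: ground hedges over `S` that reduce to `q(ε)`. -/
def WordHA.stateLang {S Q : Type} (B : WordHA S Q) (q : Q) : Set (VHedge S) :=
  { h | Ground h ∧
    Relation.ReflTransGen B.Step (hedgeMap Sum.inl h) [VTree.node (Sum.inr q) []] }

/-- `L(B)`: hedges accepted in some final state. -/
def WordHA.lang {S Q : Type} (B : WordHA S Q) : Set (VHedge S) :=
  { h | ∃ q ∈ B.final, h ∈ B.stateLang q }


open Relation

namespace VTree

/-- The tree `x(ε)` for a state `x`. -/
def ofState {S Q : Type} (x : Q) : VTree (S ⊕ Q) := .node (.inr x) []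

theorem map_eq_node {α β : Type} {f : α → β} {t : VTree α} {b : β} {ts : VHedge β}
    (h : t.map f = .node b ts) : ∃ a ts', t = .node a ts' ∧ b = f a ∧ ts = hedgeMap f ts' := by
  cases t with
  | var => simp [VTree.map] at h
  | node a ts' =>
    rw [VTree.map, VTree.node.injEq] at h
    exact ⟨a, ts', rfl, h.1.symm, by simp [← h.2, hedgeMap]⟩

theorem map_node {α β : Type} (f : α → β) (a : α) (ts : VHedge α) :
    (VTree.node a ts).map f = .node (f a) (hedgeMap f ts) := by
  simp [VTree.map, hedgeMap]

end VTree

open VTree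

/-- Bottom-up evaluation of a hedge to a word over `X`. A leaf `π x` may be evaluated to `x`, and
`a(h)` may be evaluated to `x` whenever `h` evaluates to some `u` with `Acc a u x`. -/
inductive HedgeEval {S X Y : Type} (π : X → Y) (Acc : S → List X → X → Prop) :
    VHedge (S ⊕ Y) → List X → Prop where
  | nil : HedgeEval π Acc [] []
  | leaf {h : VHedge (S ⊕ Y)} {u : List X} (x : X) :
      HedgeEval π Acc h u → HedgeEval π Acc (VTree.ofState (π x) :: h) (x :: u)
  | node {a : S} {ts h : VHedge (S ⊕ Y)} {v u : List X} {x : X} :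
      HedgeEval π Acc ts v → Acc a v x → HedgeEval π Acc h u →
      HedgeEval π Acc (.node (.inl a) ts :: h) (x :: u)

namespace HedgeEval

variable {S X Y : Type} {π : X → Y} {Acc : S → List X → X → Prop}

theorem append {h₁ h₂ : VHedge (S ⊕ Y)} {u₁ u₂ : List X} (H₁ : HedgeEval π Acc h₁ u₁)
    (H₂ : HedgeEval π Acc h₂ u₂) : HedgeEval π Acc (h₁ ++ h₂) (u₁ ++ u₂) := by
  induction H₁ with
  | nil => exact H₂
  | leaf x _ ih => exact .leaf x ih
  | node hv ha _ _ ih => exact .node hv ha ih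

theorem exists_of_append {h₁ h₂ : VHedge (S ⊕ Y)} {u : List X}
    (H : HedgeEval π Acc (h₁ ++ h₂) u) :
    ∃ u₁ u₂, u = u₁ ++ u₂ ∧ HedgeEval π Acc h₁ u₁ ∧ HedgeEval π Acc h₂ u₂ := by
  induction h₁ generalizing u with
  | nil => exact ⟨[], u, rfl, .nil, H⟩
  | cons t h₁ ih =>
    rw [List.cons_append] at H
    cases H with
    | leaf x H' =>
      obtain ⟨u₁, u₂, rfl, H₁, H₂⟩ := ih H'
      exact ⟨x :: u₁, u₂, rfl, .leaf x H₁, H₂⟩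
    | node hv ha H' =>
      obtain ⟨u₁, u₂, rfl, H₁, H₂⟩ := ih H'
      exact ⟨_ :: u₁, u₂, rfl, .node hv ha H₁, H₂⟩

theorem exists_of_leaf {y : Y} {u : List X} (H : HedgeEval π Acc [ofState y] u) :
    ∃ x, π x = y ∧ u = [x] := by
  generalize ht : ([ofState y] : VHedge (S ⊕ Y)) = h at H
  cases H with
  | nil => simp at ht
  | leaf x H =>
    simp only [VTree.ofState, List.cons.injEq, node.injEq, Sum.inr.injEq, and_true] at ht
    obtain ⟨rfl, rfl⟩ := ht
    cases H
    exact ⟨x, rfl, rfl⟩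
  | node => simp [VTree.ofState] at ht

theorem map_leaf (u : List X) :
    HedgeEval π Acc (u.map fun x => (ofState (π x) : VTree (S ⊕ Y))) u := by
  induction u with
  | nil => exact .nil
  | cons x u ih => exact .leaf x ih

/-- Evaluation depends only on the acceptance predicate, up to a relation on values, for hedges
without states. -/
theorem transfer {X' Y' : Type} {π' : X' → Y'} {Acc' : S → List X' → X' → Prop}
    {ρ : X → X' → Prop}
    (hAcc : ∀ a u x u', Acc a u x → List.Forall₂ ρ u u' → ∃ x', ρ x x' ∧ Acc' a u' x')
    {h : VHedge S} {u : List X} (H : HedgeEval π Acc (hedgeMap Sum.inl h) u) :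
    ∃ u', List.Forall₂ ρ u u' ∧ HedgeEval π' Acc' (hedgeMap Sum.inl h) u' := by
  generalize hk : hedgeMap Sum.inl h = k at H
  induction H generalizing h with
  | nil =>
    obtain rfl : h = [] := List.map_eq_nil_iff.1 hk
    exact ⟨[], .nil, .nil⟩
  | leaf x _ _ =>
    obtain ⟨t, h, rfl, ht, -⟩ := List.map_eq_cons_iff.1 hk
    obtain ⟨_, _, _, hf, _⟩ := map_eq_node ht
    cases hf
  | node _ ha _ ihv ihu =>
    obtain ⟨t, h, rfl, ht, hh⟩ := List.map_eq_cons_iff.1 hk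
    obtain ⟨b, ts, rfl, hb, rfl⟩ := map_eq_node ht
    cases hb
    obtain ⟨v', hv', Hv'⟩ := ihv rfl
    obtain ⟨u', hu', Hu'⟩ := ihu hh
    obtain ⟨x', hx', ha'⟩ := hAcc _ _ _ _ ha hv'
    refine ⟨x' :: u', .cons hx' hu', ?_⟩
    rw [hedgeMap, List.map_cons, map_node]
    exact .node Hv' ha' Hu'

end HedgeEval

section Rewriting

variable {S X Y : Type} {π : X → Y} {Acc : S → List X → X → Prop}

/-- Every value of `h'` derives, in the sense of `G`, some value of `h`. -/
def EvalPullback (π : X → Y) (Acc : S → List X → X → Prop) (G : List X → List X → Prop)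
    (h h' : VHedge (S ⊕ Y)) : Prop :=
  ∀ u, HedgeEval π Acc h' u → ∃ v, G u v ∧ HedgeEval π Acc h v

namespace EvalPullback

variable {G : List X → List X → Prop} {h h' : VHedge (S ⊕ Y)}

theorem append (happ : ∀ l r u v, G u v → G (l ++ u ++ r) (l ++ v ++ r))
    (pre post : VHedge (S ⊕ Y))
    (H : EvalPullback π Acc G h h') :
    EvalPullback π Acc G (pre ++ h ++ post) (pre ++ h' ++ post) := by
  intro u hu
  obtain ⟨_, r, rfl, hlu, hr⟩ := hu.exists_of_append
  obtain ⟨l, u, rfl, hl, hu⟩ := hlu.exists_of_append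
  obtain ⟨v, hG, hv⟩ := H u hu
  exact ⟨l ++ v ++ r, happ _ _ _ _ hG, (hl.append hv).append hr⟩

theorem node (hrefl : ∀ u, G u u) (hAcc : ∀ a u v x, Acc a u x → G u v → Acc a v x)
    (hne : h' ≠ []) (a : S ⊕ Y) (H : EvalPullback π Acc G h h') :
    EvalPullback π Acc G [.node a h] [.node a h'] := by
  intro u hu
  generalize ht : [VTree.node a h'] = k at hu
  cases hu with
  | nil => simp at ht
  | leaf x _ =>
    simp only [VTree.ofState, List.cons.injEq, VTree.node.injEq] at ht
    exact absurd ht.1.2 hne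
  | node hv ha hu =>
    simp only [List.cons.injEq, VTree.node.injEq] at ht
    obtain ⟨⟨rfl, rfl⟩, rfl⟩ := ht
    obtain ⟨v', hG, hv'⟩ := H _ hv
    exact ⟨_, hrefl _, .node hv' (hAcc _ _ _ _ ha hG) hu⟩

theorem reflTransGen {R : VHedge (S ⊕ Y) → VHedge (S ⊕ Y) → Prop} (hrefl : ∀ u, G u u)
    (htrans : ∀ u v w, G u v → G v w → G u w) (hR : ∀ h h', R h h' → EvalPullback π Acc G h h')
    (H : ReflTransGen R h h') : EvalPullback π Acc G h h' := by
  induction H using ReflTransGen.head_induction_on with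
  | refl => exact fun u hu => ⟨u, hrefl u, hu⟩
  | head hstep _ ih =>
    intro u hu
    obtain ⟨v, huv, hv⟩ := ih u hu
    obtain ⟨w, hvw, hw⟩ := hR _ _ hstep v hv
    exact ⟨w, htrans _ _ _ huv hvw, hw⟩

end EvalPullback

/-- A rewrite relation on hedges closed under contexts reduces a hedge to any of its values, as soon
as it does so for the hedges of height two. -/
theorem HedgeEval.reflTransGen {R : VHedge (S ⊕ Y) → VHedge (S ⊕ Y) → Prop}
    (hhor : ∀ h h' pre post, R h h' → R (pre ++ h ++ post) (pre ++ h' ++ post))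
    (hver : ∀ h h' a, R h h' → R [.node a h] [.node a h'])
    (hAcc : ∀ a u x, Acc a u x →
      ReflTransGen R [.node (.inl a) (u.map fun x => ofState (π x))] [ofState (π x)])
    {h : VHedge (S ⊕ Y)} {u : List X} (H : HedgeEval π Acc h u) :
    ReflTransGen R h (u.map fun x => ofState (π x)) := by
  induction H with
  | nil => exact .refl
  | leaf x _ ih =>
    exact ih.lift (ofState (π x) :: ·) fun h h' hs => by
      simpa using hhor h h' [ofState (π x)] [] hs
  | @node a ts h v u x _ ha _ ihv ihu =>
    have h₁ : ReflTransGen R (.node (.inl a) ts :: h) (ofState (π x) :: h) :=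
      ((ihv.lift (fun h => [VTree.node (.inl a) h]) fun _ _ => hver _ _ _).trans
        (hAcc _ _ _ ha)).lift (· ++ h) fun k k' hs => by simpa using hhor k k' [] h hs
    exact h₁.trans <| ihu.lift (ofState (π x) :: ·) fun h h' hs => by
      simpa using hhor h h' [ofState (π x)] [] hs

end Rewriting

namespace WordHA

variable {S Q : Type} (B : WordHA S Q)

/-- `B.Acc a w q` means that `B` has a transition `a(L) → q` with `w ∈ L`. -/
def Acc (a : S) (w : List Q) (q : Q) : Prop := ∃ L, (a, L, q) ∈ B.trans ∧ w ∈ L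

variable {B}

theorem Step.ne_nil {h h' : VHedge (S ⊕ Q)} (H : B.Step h h') : h' ≠ [] := by
  induction H <;> simp_all

theorem Step.evalPullback {h h' : VHedge (S ⊕ Q)} (H : B.Step h h') :
    EvalPullback id B.Acc Eq h h' := by
  induction H with
  | @trans _ _ _ w ht hw =>
    intro u hu
    obtain ⟨_, rfl, rfl⟩ := hu.exists_of_leaf
    exact ⟨_, rfl, .node (.map_leaf _) ⟨_, ht, hw⟩ .nil⟩
  | ctx_hor pre post _ ih => exact ih.append (by rintro _ _ _ _ rfl; rfl) pre post
  | ctx_ver a hs ih =>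
    exact ih.node (fun _ => rfl) (by rintro _ _ _ _ h rfl; exact h) hs.ne_nil a

theorem reflTransGen_step_iff {h : VHedge (S ⊕ Q)} {q : Q} :
    ReflTransGen B.Step h [.node (.inr q) []] ↔ HedgeEval id B.Acc h [q] := by
  constructor
  · intro H
    obtain ⟨_, rfl, hv⟩ := EvalPullback.reflTransGen (fun _ => rfl) (fun _ _ _ => Eq.trans)
      (fun _ _ => Step.evalPullback) H [q] (.leaf q .nil)
    exact hv
  · refine HedgeEval.reflTransGen (fun _ _ pre post => Step.ctx_hor pre post)
      (fun _ _ a => Step.ctx_ver a) ?_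
    rintro a w q ⟨L, ht, hw⟩
    exact .single (.trans ht hw)

end WordHA

/-- One step of context-free rewriting with the productions `P`. -/
def RewriteStep {X : Type} (P : Set (X × List X)) (u v : List X) : Prop :=
  ∃ p ∈ P, ∃ l r, u = l ++ [p.1] ++ r ∧ v = l ++ p.2 ++ r

theorem RewriteStep.append {X : Type} {P : Set (X × List X)} (l r : List X) {u v : List X}
    (H : ReflTransGen (RewriteStep P) u v) :
    ReflTransGen (RewriteStep P) (l ++ u ++ r) (l ++ v ++ r) := by
  refine H.lift (fun u => l ++ u ++ r) ?_
  rintro _ _ ⟨p, hp, l', r', rfl, rfl⟩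
  exact ⟨p, hp, l ++ l', r' ++ r, by simp, by simp⟩

namespace CF2HA

variable {S X Y : Type}

/-- The automaton with a horizontal transition `π x₁ … π xₙ → π x` for each production
`x → x₁ … xₙ` in `P`, and a vertical transition `a(π x) → π y` for each `(a, x, y)` in `V`. -/
def ofProductions (π : X → Y) (P : Set (X × List X)) (V : Set (S × X × X)) (F : Set Y)
    (hP : P.Finite) (hV : V.Finite) : CF2HA S Y where
  final := F
  hor := (fun p => (p.2.map fun x => (.inr (π x), false), π p.1)) '' P
  ver := (fun v => (.inl v.1, .inr (π v.2.1), false, π v.2.2)) '' V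
  hor_fin := hP.image _
  ver_fin := hV.image _

/-- `VerAcc P V a u y` means that there is `(a, x, y)` in `V` such that `u` derives from `x`. -/
def VerAcc (P : Set (X × List X)) (V : Set (S × X × X)) (a : S) (u : List X) (y : X) : Prop :=
  ∃ x, (a, x, y) ∈ V ∧ ReflTransGen (RewriteStep P) [x] u

theorem Step.ne_nil {A : CF2HA S Y} {h h' : VHedge (S ⊕ Y)} (H : A.Step h h') : h' ≠ [] := by
  induction H <;> simp_all

variable {π : X → Y} {P : Set (X × List X)} {V : Set (S × X × X)} {F : Set Y}
  {hP : P.Finite} {hV : V.Finite}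

theorem Step.evalPullback (hPπ : ∀ p ∈ P, ∀ x, π x = π p.1 → x = p.1)
    (hVπ : ∀ v ∈ V, ∀ x, π x = π v.2.2 → x = v.2.2)
    {h h' : VHedge (S ⊕ Y)} (H : (ofProductions π P V F hP hV).Step h h') :
    EvalPullback π (VerAcc P V) (ReflTransGen (RewriteStep P)) h h' := by
  induction H with
  | hor hs hp hlen hemp =>
    obtain ⟨⟨x, w⟩, hxw, heq⟩ := hp
    cases heq
    intro u hu
    have hnil : ∀ k ∈ hs, k = [] := by
      intro k hk
      obtain ⟨i, hi, rfl⟩ := List.getElem_of_mem hk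
      have hi' : i < w.length := by simpa [hlen] using hi
      exact hemp ((.inr (π w[i]), false), hs[i])
        (List.mem_iff_getElem.2 ⟨i, by simp [hi, hi'], by simp⟩) rfl
    obtain rfl : hs = List.replicate w.length [] :=
      List.eq_replicate_iff.2 ⟨by simpa using hlen, hnil⟩
    simp only [List.flatten_replicate_nil] at hu
    obtain ⟨y, hy, rfl⟩ := HedgeEval.exists_of_leaf hu
    obtain rfl : y = x := hPπ _ hxw y hy
    refine ⟨w, .single ⟨_, hxw, [], [], by simp, by simp⟩, ?_⟩
    convert HedgeEval.map_leaf (S := S) (Acc := VerAcc P V) (π := π) w using 1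
    apply List.ext_getElem <;> simp [VTree.ofState]
  | ver k hv hk =>
    obtain ⟨⟨a, x, y⟩, hxy, heq⟩ := hv
    cases heq
    obtain rfl := hk rfl
    intro u hu
    obtain ⟨z, hz, rfl⟩ := HedgeEval.exists_of_leaf hu
    obtain rfl : z = y := hVπ _ hxy z hz
    exact ⟨[z], .refl, .node (.leaf x .nil) ⟨x, hxy, .refl⟩ .nil⟩
  | ctx_hor pre post _ ih =>
    exact ih.append (fun l r _ _ => RewriteStep.append l r) pre post
  | ctx_ver a hs ih =>
    exact ih.node (fun _ => .refl) (fun _ _ _ _ ⟨x, hx, hu⟩ huv => ⟨x, hx, hu.trans huv⟩)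
      hs.ne_nil a

theorem reflTransGen_step_of_derives {u v : List X} (H : ReflTransGen (RewriteStep P) u v) :
    ReflTransGen (ofProductions π P V F hP hV).Step (v.map fun x => ofState (π x))
      (u.map fun x => ofState (π x)) := by
  induction H with
  | refl => exact .refl
  | tail _ hs ih =>
    refine .head ?_ ih
    obtain ⟨⟨x, w⟩, hp, l, r, rfl, rfl⟩ := hs
    simp only [List.map_append]
    refine .ctx_hor _ _ ?_
    convert CF2HA.Step.hor (A := ofProductions π P V F hP hV) (List.replicate w.length [])
      ⟨_, hp, rfl⟩ (by simp) ?_ using 1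
    · apply List.ext_getElem <;> simp [VTree.ofState]
    · simp [VTree.ofState]
    · intro pb hpb _
      exact (List.mem_replicate.1 (List.of_mem_zip hpb).2).2

theorem reflTransGen_step_iff (hPπ : ∀ p ∈ P, ∀ x, π x = π p.1 → x = p.1)
    (hVπ : ∀ v ∈ V, ∀ x, π x = π v.2.2 → x = v.2.2) {y : X} (hy : ∀ p ∈ P, p.1 ≠ y)
    {h : VHedge (S ⊕ Y)} :
    ReflTransGen (ofProductions π P V F hP hV).Step h [.node (.inr (π y)) []] ↔
      HedgeEval π (VerAcc P V) h [y] := by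
  constructor
  · intro H
    obtain ⟨v, hyv, hv⟩ := EvalPullback.reflTransGen (fun _ => .refl) (fun _ _ _ => .trans)
      (fun _ _ => Step.evalPullback hPπ hVπ) H [y] (.leaf y .nil)
    obtain rfl | ⟨_, ⟨p, hp, l, r, hl, -⟩, -⟩ := hyv.cases_head
    · exact hv
    · have : p.1 ∈ [y] := hl ▸ by simp
      exact absurd (List.mem_singleton.1 this) (hy p hp)
  · refine HedgeEval.reflTransGen (fun _ _ pre post => Step.ctx_hor pre post)
      (fun _ _ a => Step.ctx_ver a) ?_
    rintro a u y ⟨x, hx, hu⟩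
    have hderiv := reflTransGen_step_of_derives (S := S) (π := π) (V := V) (F := F) (hP := hP)
      (hV := hV) hu
    have hlift := hderiv.lift (p := (ofProductions π P V F hP hV).Step)
      (fun h => [VTree.node (.inl a) h]) fun _ _ hs => Step.ctx_ver _ hs
    exact hlift.tail (.ver (b := false) [] ⟨_, hx, rfl⟩ fun _ => rfl)

end CF2HA

section Grammars

variable {Q I : Type} (g : I → ContextFreeGrammar Q)

/-- The symbols of the `i`-th grammar, inside the disjoint union of the nonterminals of all the
grammars `g` and the common terminals. -/
def symbolEmb (i : I) : Symbol Q (g i).NT → Q ⊕ Σ i, (g i).NT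
  | .terminal q => .inl q
  | .nonterminal n => .inr ⟨i, n⟩

theorem symbolEmb_injective (i : I) : Function.Injective (symbolEmb g i) := by
  rintro (_ | _) (_ | _) h <;> simp_all [symbolEmb]

/-- The productions of all the grammars `g`. -/
def unionProductions : Set ((Q ⊕ Σ i, (g i).NT) × List (Q ⊕ Σ i, (g i).NT)) :=
  ⋃ i, (fun r : ContextFreeRule Q (g i).NT => (.inr ⟨i, r.input⟩,
    r.output.map (symbolEmb g i))) '' (g i).rules

theorem unionProductions_finite [Finite I] : (unionProductions g).Finite :=
  Set.finite_iUnion fun i => (g i).rules.finite_toSet.image _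

variable {g}

theorem derives_unionProductions {i : I} {u v : List (Symbol Q (g i).NT)}
    (H : (g i).Derives u v) :
    ReflTransGen (RewriteStep (unionProductions g)) (u.map (symbolEmb g i))
      (v.map (symbolEmb g i)) := by
  refine H.lift _ ?_
  rintro u v ⟨r, hr, huv⟩
  obtain ⟨l, s, rfl, rfl⟩ := huv.exists_parts
  exact ⟨_, Set.mem_iUnion.2 ⟨i, r, hr, rfl⟩, l.map (symbolEmb g i), s.map (symbolEmb g i),
    by simp [symbolEmb], by simp⟩

theorem exists_derives_of_unionProductions {i : I} {u : List (Symbol Q (g i).NT)}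
    {v : List (Q ⊕ Σ i, (g i).NT)}
    (H : ReflTransGen (RewriteStep (unionProductions g)) (u.map (symbolEmb g i)) v) :
    ∃ w, v = w.map (symbolEmb g i) ∧ (g i).Derives u w := by
  induction H with
  | refl => exact ⟨u, rfl, ReflTransGen.refl⟩
  | tail _ hs ih =>
    obtain ⟨w, rfl, hw⟩ := ih
    obtain ⟨p, hp, l, s, hl, rfl⟩ := hs
    obtain ⟨j, r, hr, rfl⟩ := Set.mem_iUnion.1 hp
    obtain ⟨_, s, rfl, hlt, rfl⟩ := List.map_eq_append_iff.1 hl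
    obtain ⟨l, t, rfl, rfl, ht⟩ := List.map_eq_append_iff.1 hlt
    obtain ⟨x, rfl, hx⟩ := List.map_eq_singleton_iff.1 ht
    cases x with
    | terminal => simp [symbolEmb] at hx
    | nonterminal n =>
      simp only [symbolEmb, Sum.inr.injEq, Sigma.mk.injEq] at hx
      obtain ⟨rfl, hn⟩ := hx
      cases hn
      exact ⟨l ++ r.output ++ s, by simp,
        hw.tail ⟨r, hr, r.rewrites_of_exists_parts l s⟩⟩

theorem mem_language_iff_unionProductions {i : I} {w : List Q} :
    w ∈ (g i).language ↔ ReflTransGen (RewriteStep (unionProductions g))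
      [.inr ⟨i, (g i).initial⟩] (w.map .inl) := by
  have hw : w.map .inl = (w.map Symbol.terminal).map (symbolEmb g i) := by
    simp [symbolEmb, Function.comp_def]
  rw [hw]
  refine ⟨derives_unionProductions, fun H => ?_⟩
  obtain ⟨v, hv, hd⟩ := exists_derives_of_unionProductions (i := i)
    (u := [.nonterminal (g i).initial]) H
  rwa [← (List.map_injective_iff.2 (symbolEmb_injective g i)) hv] at hd

end Grammars

/-- A type can be collapsed to a finite one without identifying the elements of a given finite set
with anything else. -/
theorem exists_finite_collapse {X : Type} {F : Set X} (hF : F.Finite) :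
    ∃ (Y : Type) (_ : Finite Y) (π : X → Y), ∀ x ∈ F, ∀ y, π y = π x → y = x := by
  classical
  have := hF.to_subtype
  refine ⟨Option F, inferInstance, fun x => if hx : x ∈ F then some ⟨x, hx⟩ else none, ?_⟩
  intro x hx y hy
  by_cases hyF : y ∈ F <;> simp_all

/-- Every CFHA language is a CF²HA language; moreover the CF²HA can be taken
with only variable-free transitions of the forms `p₁…pₙ → q` (horizontal) and
`a(q₁) → q₂` with `a ∈ Σ` and `q₁, q₂` states (vertical). -/
theorem cf2ha_of_cfha {S Q : Type} [Finite S] [Finite Q]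
    (B : WordHA S Q) (hB : B.IsCFHA) :
    ∃ (Q' : Type) (_ : Finite Q') (A : CF2HA S Q'),
      A.lang = B.lang ∧
      (∀ t ∈ A.hor, ∀ pb ∈ t.1, pb.2 = false) ∧
      (∀ v ∈ A.ver, (∃ a : S, v.1 = Sum.inl a) ∧
        (∃ q₁ : Q', v.2.1 = Sum.inr q₁) ∧ v.2.2.1 = false) := by
  choose g hg using fun i : B.trans => hB i.1 i.2
  have := B.trans_fin.to_subtype
  let P := unionProductions g
  have hP : P.Finite := unionProductions_finite g
  let V : Set (S × (Q ⊕ Σ i, (g i).NT) × (Q ⊕ Σ i, (g i).NT)) :=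
    Set.range fun i => (i.1.1, .inr ⟨i, (g i).initial⟩, .inl i.1.2.2)
  have hV : V.Finite := Set.finite_range _
  obtain ⟨Y, hY, π, hπ⟩ := exists_finite_collapse
    ((hP.image Prod.fst).union (Set.finite_range (Sum.inl : Q → Q ⊕ Σ i, (g i).NT)))
  have hPπ : ∀ p ∈ P, ∀ x, π x = π p.1 → x = p.1 := fun p hp => hπ _ (.inl ⟨p, hp, rfl⟩)
  have hVπ : ∀ v ∈ V, ∀ x, π x = π v.2.2 → x = v.2.2 := by
    rintro _ ⟨i, rfl⟩
    exact hπ _ (.inr ⟨_, rfl⟩)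
  have hinl : ∀ q : Q, ∀ p ∈ P, p.1 ≠ .inl q := by
    rintro q p hp
    obtain ⟨j, r, -, rfl⟩ := Set.mem_iUnion.1 hp
    simp
  have hacc : ∀ a w y, CF2HA.VerAcc P V a (w.map .inl) y ↔ ∃ q, y = .inl q ∧ B.Acc a w q := by
    intro a w y
    constructor
    · rintro ⟨_, ⟨i, hi⟩, hw⟩
      cases hi
      exact ⟨_, rfl, _, i.2, hg i ▸ mem_language_iff_unionProductions.2 hw⟩
    · rintro ⟨q, rfl, L, hL, hw⟩
      exact ⟨_, ⟨⟨_, hL⟩, rfl⟩, mem_language_iff_unionProductions.1 ((hg ⟨_, hL⟩).symm ▸ hw)⟩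
  have heval : ∀ (h : VHedge S) (q : Q), HedgeEval π (CF2HA.VerAcc P V) (hedgeMap .inl h) [.inl q] ↔
      HedgeEval id B.Acc (hedgeMap .inl h) [q] := by
    intro h q
    constructor
    · intro H
      obtain ⟨u, hu, H'⟩ := H.transfer (π' := id) (Acc' := B.Acc) (ρ := fun x q => x = .inl q) <| by
        intro a u x w ha hw
        obtain rfl : u = w.map .inl := by
          rwa [← List.forall₂_eq_eq_eq, List.forall₂_map_right_iff]
        exact (hacc a w x).1 ha
      obtain ⟨_, _, hq, hnil, rfl⟩ := List.forall₂_cons_left_iff.1 hu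
      cases hq
      cases hnil
      exact H'
    · intro H
      obtain ⟨u, hu, H'⟩ := H.transfer (π' := π) (Acc' := CF2HA.VerAcc P V)
        (ρ := fun q x => .inl q = x) <| by
        intro a w q u ha hw
        obtain rfl : w.map .inl = u := by
          rwa [← List.forall₂_eq_eq_eq, List.forall₂_map_left_iff]
        exact ⟨_, rfl, (hacc a w _).2 ⟨q, rfl, ha⟩⟩
      obtain ⟨_, _, rfl, hnil, rfl⟩ := List.forall₂_cons_left_iff.1 hu
      cases hnil
      exact H'
  refine ⟨Y, hY, .ofProductions π P V ((fun q => π (.inl q)) '' B.final) hP hV, ?_, ?_, ?_⟩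
  · ext h
    simp only [CF2HA.lang, CF2HA.stateLang, WordHA.lang, WordHA.stateLang, Set.mem_ofPred_eq,
      WordHA.reflTransGen_step_iff]
    constructor
    · rintro ⟨_, ⟨q, hq, rfl⟩, hh, H⟩
      exact ⟨q, hq, hh, (heval h q).1 ((CF2HA.reflTransGen_step_iff hPπ hVπ (hinl q)).1 H)⟩
    · rintro ⟨q, hq, hh, H⟩
      exact ⟨_, ⟨q, hq, rfl⟩, hh,
        (CF2HA.reflTransGen_step_iff hPπ hVπ (hinl q)).2 ((heval h q).2 H)⟩
  · rintro _ ⟨p, -, rfl⟩ pb hpb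
    obtain ⟨x, -, rfl⟩ := List.mem_map.1 hpb
    rfl
  · rintro _ ⟨v, -, rfl⟩
    exact ⟨⟨_, rfl⟩, ⟨_, rfl⟩, rfl⟩
end

section
/- Every hedge automaton language is a bidimensional context-free hedge automaton language: for every hedge automaton B over a finite alphabet Σ there exists a CF²HA A over Σ with L(A) = L(B); moreover A can be taken with state set Q = Q_h ⊎ Q_v and only variable-free transitions of the forms ε → q_h, q_h · q_v → q'_h, and a(q_h) → q_v with q_h, q'_h ∈ Q_h, q_v ∈ Q_v, a ∈ Σ. -/
open Relation

theorem VTree.map_node_s7 {α β : Type} (f : α → β) (a : α) (ts : VHedge α) :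
    (VTree.node a ts).map f = VTree.node (f a) (hedgeMap f ts) := by
  simp [VTree.map, hedgeMap]

theorem hedgeMap_hedgeMap_of_ground {α β γ : Type} (f : α → β) (g : β → γ) {h : VHedge α}
    (hh : Ground h) : hedgeMap g (hedgeMap f h) = hedgeMap (g ∘ f) h := by
  have key : ∀ t : VTree α, GroundT t → (t.map f).map g = t.map (g ∘ f) := by
    intro t ht
    induction ht with
    | @node a ts _ ih =>
      simp only [VTree.map_node_s7, Function.comp_apply, VTree.node.injEq, true_and]
      simpa [hedgeMap] using ih
  simpa [hedgeMap] using fun t ht => key t (hh t ht)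

/-- The hedge of childless nodes labelled by the letters of a word of states. -/
def stateWord {S Q : Type} (w : List Q) : VHedge (S ⊕ Q) :=
  w.map fun p => VTree.node (Sum.inr p) []

namespace CF2HA

variable {S Q : Type} {A : CF2HA S Q}

theorem reflTransGen_append {h h' : VHedge (S ⊕ Q)} (pre post : VHedge (S ⊕ Q))
    (H : ReflTransGen A.Step h h') :
    ReflTransGen A.Step (pre ++ h ++ post) (pre ++ h' ++ post) :=
  H.lift (fun k => pre ++ k ++ post) fun _ _ => Step.ctx_hor pre post

theorem reflTransGen_node {h h' : VHedge (S ⊕ Q)} (a : S ⊕ Q)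
    (H : ReflTransGen A.Step h h') :
    ReflTransGen A.Step [VTree.node a h] [VTree.node a h'] :=
  H.lift (fun k => [VTree.node a k]) fun _ _ => Step.ctx_ver a

end CF2HA

namespace WordHA

variable {S Q : Type} {B : WordHA S Q}

theorem reflTransGen_append {h h' k k' : VHedge (S ⊕ Q)}
    (H : ReflTransGen B.Step h h') (K : ReflTransGen B.Step k k') :
    ReflTransGen B.Step (h ++ k) (h' ++ k') := by
  have H₁ : ReflTransGen B.Step (h ++ k) (h' ++ k) :=
    H.lift (fun l => l ++ k) fun _ _ s => Step.ctx_hor [] k s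
  have H₂ : ReflTransGen B.Step (h' ++ k) (h' ++ k') :=
    K.lift (fun l => h' ++ l) fun _ _ s => by simpa using Step.ctx_hor h' [] s
  exact H₁.trans H₂

theorem reflTransGen_node {h h' : VHedge (S ⊕ Q)} (a : S ⊕ Q)
    (H : ReflTransGen B.Step h h') :
    ReflTransGen B.Step [VTree.node a h] [VTree.node a h'] :=
  H.lift (fun k => [VTree.node a k]) fun _ _ => Step.ctx_ver a

section Simulation

variable (B) {σ : B.trans → Type} (M : ∀ τ, DFA Q (σ τ))

/-- The CF²HA simulating a hedge automaton whose horizontal languages are recognized by the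
automata `M τ`: it reads the children of a node with one of these automata. -/
def toCF2HA [Finite Q] [∀ τ, Finite (σ τ)] : CF2HA S ((Σ τ, σ τ) ⊕ Q) where
  final := Sum.inr '' B.final
  hor :=
    (Set.range fun τ : B.trans => ([], Sum.inl ⟨τ, (M τ).start⟩)) ∪
    (Set.range fun x : (Σ τ, σ τ) × Q =>
      ([(Sum.inr (Sum.inl x.1), false), (Sum.inr (Sum.inr x.2), false)],
        Sum.inl ⟨x.1.1, (M x.1.1).step x.1.2 x.2⟩))
  ver := (fun x : Σ τ, σ τ =>
      (Sum.inl x.1.1.1, Sum.inr (Sum.inl x), false, Sum.inr x.1.1.2.2)) ''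
    {x | x.2 ∈ (M x.1).accept}
  hor_fin := by
    have := B.trans_fin.to_subtype
    exact (Set.finite_range _).union (Set.finite_range _)
  ver_fin := by
    have := B.trans_fin.to_subtype
    exact (Set.toFinite _).image _

variable {B}

/-- The inclusion of the labels of the hedge automaton into those of the simulating CF²HA. -/
def embedLabel : S ⊕ Q → S ⊕ ((Σ τ, σ τ) ⊕ Q) := Sum.map id Sum.inr

theorem toCF2HA_read_word [Finite Q] [∀ τ, Finite (σ τ)] (τ : B.trans) (s : σ τ) (w : List Q) :
    ReflTransGen (B.toCF2HA M).Step
      (VTree.node (Sum.inr (Sum.inl ⟨τ, s⟩)) [] :: hedgeMap embedLabel (stateWord w))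
      [VTree.node (Sum.inr (Sum.inl ⟨τ, (M τ).evalFrom s w⟩)) []] := by
  induction w generalizing s with
  | nil => exact .refl
  | cons p w ih =>
    refine ReflTransGen.head ?_ (ih ((M τ).step s p))
    have := CF2HA.Step.hor (A := B.toCF2HA M) [[], []]
      (Or.inr ⟨(⟨τ, s⟩, p), rfl⟩) rfl (by simp)
    simpa [stateWord, hedgeMap, VTree.map_node_s7, embedLabel] using
      CF2HA.Step.ctx_hor [] (hedgeMap embedLabel (stateWord w)) this

theorem toCF2HA_simulates [Finite Q] [∀ τ, Finite (σ τ)]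
    (hM : ∀ τ, (M τ).accepts = τ.1.2.1) {h h' : VHedge (S ⊕ Q)} (H : B.Step h h') :
    ReflTransGen (B.toCF2HA M).Step (hedgeMap embedLabel h) (hedgeMap embedLabel h') := by
  induction H with
  | @trans a L q w ht hw =>
    let τ : B.trans := ⟨(a, L, q), ht⟩
    have hacc : (M τ).evalFrom (M τ).start w ∈ (M τ).accept := by
      have : w ∈ (M τ).accepts := by rw [hM τ]; exact hw
      exact this
    have h₁ : (B.toCF2HA M).Step [] [VTree.node (Sum.inr (Sum.inl ⟨τ, (M τ).start⟩)) []] :=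
      CF2HA.Step.hor (A := B.toCF2HA M) [] (Or.inl ⟨τ, rfl⟩) rfl (by simp)
    have h₂ := (CF2HA.Step.ctx_hor [] (hedgeMap embedLabel (stateWord w)) h₁)
    have h₃ := CF2HA.reflTransGen_node (Sum.inl a)
      (ReflTransGen.head h₂ (toCF2HA_read_word M τ _ w))
    have h₄ := CF2HA.Step.ver (A := B.toCF2HA M) [] ⟨⟨τ, _⟩, hacc, rfl⟩ fun _ => rfl
    simpa [hedgeMap, VTree.map_node_s7, embedLabel, stateWord, τ] using h₃.tail h₄
  | ctx_hor pre post _ ih =>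
    simpa [hedgeMap] using CF2HA.reflTransGen_append
      (hedgeMap embedLabel pre) (hedgeMap embedLabel post) ih
  | ctx_ver a _ ih =>
    simpa [hedgeMap, VTree.map_node_s7] using CF2HA.reflTransGen_node (embedLabel a) ih

/-- `Unfolds M k m` states that `m` arises from `k` by replacing each tree whose root is a
horizontal state `⟨τ, s⟩` by some word of states leading `M τ` from its start state to `s`. -/
inductive Unfolds : VHedge (S ⊕ ((Σ τ, σ τ) ⊕ Q)) → VHedge (S ⊕ Q) → Prop where
  | nil : Unfolds [] []
  | node (a : S ⊕ Q) {ts k : VHedge (S ⊕ ((Σ τ, σ τ) ⊕ Q))} {ms m : VHedge (S ⊕ Q)} :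
      Unfolds ts ms → Unfolds k m →
      Unfolds (VTree.node (embedLabel a) ts :: k) (VTree.node a ms :: m)
  | word (τ : B.trans) (w : List Q) (ts : VHedge (S ⊕ ((Σ τ, σ τ) ⊕ Q)))
      {k : VHedge (S ⊕ ((Σ τ, σ τ) ⊕ Q))} {m : VHedge (S ⊕ Q)} :
      Unfolds k m →
      Unfolds (VTree.node (Sum.inr (Sum.inl ⟨τ, (M τ).eval w⟩)) ts :: k) (stateWord w ++ m)

variable {M}

theorem Unfolds.append {k k' : VHedge (S ⊕ ((Σ τ, σ τ) ⊕ Q))} {m m' : VHedge (S ⊕ Q)}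
    (H : Unfolds M k m) (H' : Unfolds M k' m') : Unfolds M (k ++ k') (m ++ m') := by
  induction H with
  | nil => exact H'
  | node a h₁ _ _ ih => exact .node a h₁ ih
  | word τ w ts _ ih => simpa using Unfolds.word τ w ts ih

theorem unfolds_nil_iff {m : VHedge (S ⊕ Q)} : Unfolds M [] m ↔ m = [] :=
  ⟨fun H => by cases H; rfl, fun H => H ▸ .nil⟩

theorem unfolds_node_cons_iff (a : S ⊕ Q) {ts k : VHedge (S ⊕ ((Σ τ, σ τ) ⊕ Q))}
    {m : VHedge (S ⊕ Q)} :
    Unfolds M (VTree.node (embedLabel a) ts :: k) m ↔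
      ∃ ms m', Unfolds M ts ms ∧ Unfolds M k m' ∧ m = VTree.node a ms :: m' := by
  constructor
  · intro H
    generalize hl : (VTree.node (embedLabel a) ts :: k) = l at H
    cases H with
    | nil => cases hl
    | node b h₁ h₂ =>
      simp only [List.cons.injEq, VTree.node.injEq] at hl
      obtain ⟨⟨hab, rfl⟩, rfl⟩ := hl
      have : a = b := Function.Injective.sumMap Function.injective_id Sum.inr_injective hab
      exact ⟨_, _, h₁, h₂, by rw [this]⟩
    | word τ w _ _ => cases a <;> simp [embedLabel] at hl
  · rintro ⟨ms, m', h₁, h₂, rfl⟩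
    exact .node a h₁ h₂

theorem unfolds_word_cons_iff (x : Σ τ, σ τ) {ts k : VHedge (S ⊕ ((Σ τ, σ τ) ⊕ Q))}
    {m : VHedge (S ⊕ Q)} :
    Unfolds M (VTree.node (Sum.inr (Sum.inl x)) ts :: k) m ↔
      ∃ w m', (M x.1).eval w = x.2 ∧ Unfolds M k m' ∧ m = stateWord w ++ m' := by
  constructor
  · intro H
    generalize hl : (VTree.node (Sum.inr (Sum.inl x)) ts :: k) = l at H
    cases H with
    | nil => cases hl
    | node b h₁ h₂ => cases b <;> simp [embedLabel] at hl
    | word τ w _ h =>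
      simp only [List.cons.injEq, VTree.node.injEq, Sum.inr.injEq, Sum.inl.injEq] at hl
      obtain ⟨⟨rfl, rfl⟩, rfl⟩ := hl
      exact ⟨w, _, rfl, h, rfl⟩
  · rintro ⟨w, m', hw, h, rfl⟩
    obtain ⟨τ, s⟩ := x
    obtain rfl : (M τ).eval w = s := hw
    exact .word τ w ts h

theorem Unfolds.exists_of_append {k k' : VHedge (S ⊕ ((Σ τ, σ τ) ⊕ Q))} {m : VHedge (S ⊕ Q)}
    (H : Unfolds M (k ++ k') m) :
    ∃ m₁ m₂, Unfolds M k m₁ ∧ Unfolds M k' m₂ ∧ m = m₁ ++ m₂ := by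
  generalize hl : k ++ k' = l at H
  induction H generalizing k with
  | nil =>
    obtain ⟨rfl, rfl⟩ := List.append_eq_nil_iff.1 hl
    exact ⟨[], [], .nil, .nil, rfl⟩
  | @node a ts l ms m h₁ h₂ _ ih =>
    rcases List.append_eq_cons_iff.1 hl with ⟨rfl, rfl⟩ | ⟨k₀, rfl, h⟩
    · exact ⟨[], _, .nil, .node a h₁ h₂, rfl⟩
    · obtain ⟨m₁, m₂, H₁, H₂, rfl⟩ := ih h.symm
      exact ⟨_, m₂, .node a h₁ H₁, H₂, rfl⟩
  | @word τ w ts l m h₂ ih =>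
    rcases List.append_eq_cons_iff.1 hl with ⟨rfl, rfl⟩ | ⟨k₀, rfl, h⟩
    · exact ⟨[], _, .nil, .word τ w ts h₂, rfl⟩
    · obtain ⟨m₁, m₂, H₁, H₂, rfl⟩ := ih h.symm
      exact ⟨_, m₂, .word τ w ts H₁, H₂, by simp⟩

theorem unfolds_hedgeMap_of_ground {h : VHedge S} (hh : Ground h) :
    Unfolds M (hedgeMap Sum.inl h) (hedgeMap Sum.inl h) := by
  have lift : ∀ ts : VHedge S, (∀ t ∈ ts, Unfolds M [t.map Sum.inl] [t.map Sum.inl]) →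
      Unfolds M (hedgeMap Sum.inl ts) (hedgeMap Sum.inl ts) := by
    intro ts
    induction ts with
    | nil => exact fun _ => .nil
    | cons t ts ih =>
      intro H
      exact (H t (by simp)).append (ih fun u hu => H u (by simp [hu]))
  have key : ∀ t : VTree S, GroundT t → Unfolds M [t.map Sum.inl] [t.map Sum.inl] := by
    intro t ht
    induction ht with
    | @node a ts _ ih =>
      simp only [VTree.map_node_s7]
      exact .node (Sum.inl a) (lift ts ih) .nil
  exact lift h fun t ht => key t (hh t ht)

theorem Unfolds.step [Finite Q] [∀ τ, Finite (σ τ)] (hM : ∀ τ, (M τ).accepts = τ.1.2.1)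
    {k k' : VHedge (S ⊕ ((Σ τ, σ τ) ⊕ Q))} (hk : (B.toCF2HA M).Step k k')
    {m : VHedge (S ⊕ Q)} (H : Unfolds M k m) :
    ∃ m', ReflTransGen B.Step m m' ∧ Unfolds M k' m' := by
  induction hk generalizing m with
  | @hor ps q hs hmem hlen hnil =>
    rcases hmem with ⟨τ, hτ⟩ | ⟨⟨x, p⟩, hx⟩
    · obtain ⟨rfl, rfl⟩ := Prod.mk.inj hτ
      obtain rfl := unfolds_nil_iff.1 (by simpa using H)
      exact ⟨[], .refl, (unfolds_word_cons_iff _).2 ⟨[], [], rfl, .nil, rfl⟩⟩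
    · obtain ⟨rfl, rfl⟩ := Prod.mk.inj hx
      obtain ⟨h₁, h₂, rfl⟩ := List.length_eq_two.1 hlen
      obtain ⟨rfl, rfl⟩ : h₁ = [] ∧ h₂ = [] := by simpa using hnil
      obtain ⟨w, m', hw, H', rfl⟩ := (unfolds_word_cons_iff x).1 H
      obtain ⟨ms, m'', h₁, h₂, rfl⟩ := (unfolds_node_cons_iff (Sum.inr p)).1 H'
      obtain rfl := unfolds_nil_iff.1 h₁
      obtain rfl := unfolds_nil_iff.1 h₂
      exact ⟨_, .refl, (unfolds_word_cons_iff _).2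
        ⟨w ++ [p], [], by simp [DFA.eval_append_singleton, hw], .nil, by simp [stateWord]⟩⟩
  | ver h hmem hnil =>
    obtain ⟨x, hx, heq⟩ := hmem
    simp only [Prod.mk.injEq] at heq
    obtain ⟨rfl, rfl, rfl, rfl⟩ := heq
    obtain rfl := hnil rfl
    obtain ⟨ms, m', h₁, h₂, rfl⟩ := (unfolds_node_cons_iff (Sum.inl x.1.1.1)).1 H
    obtain rfl := unfolds_nil_iff.1 h₂
    obtain ⟨w, m'', hw, h₃, rfl⟩ := (unfolds_word_cons_iff x).1 h₁
    obtain rfl := unfolds_nil_iff.1 h₃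
    have hwL : w ∈ x.1.1.2.1 := by
      rw [← hM x.1, DFA.mem_accepts, hw]
      exact hx
    refine ⟨_, .single ?_, .node (Sum.inr x.1.1.2.2) .nil .nil⟩
    simpa [stateWord] using Step.trans (B := B) x.1.2 hwL
  | ctx_hor pre post _ ih =>
    obtain ⟨m₁₂, m₃, H₁₂, H₃, rfl⟩ := H.exists_of_append
    obtain ⟨m₁, m₂, H₁, H₂, rfl⟩ := H₁₂.exists_of_append
    obtain ⟨m₂', hs, H₂'⟩ := ih H₂
    exact ⟨m₁ ++ m₂' ++ m₃, reflTransGen_append (reflTransGen_append .refl hs) .refl,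
      (H₁.append H₂').append H₃⟩
  | @ctx_ver h h' a _ ih =>
    have node (b : S ⊕ Q) (H : Unfolds M [VTree.node (embedLabel b) h] m) :
        ∃ m', ReflTransGen B.Step m m' ∧ Unfolds M [VTree.node (embedLabel b) h'] m' := by
      obtain ⟨ms, m', h₁, h₂, rfl⟩ := (unfolds_node_cons_iff b).1 H
      obtain rfl := unfolds_nil_iff.1 h₂
      obtain ⟨ms', hs, hu⟩ := ih h₁
      exact ⟨_, reflTransGen_node b hs, .node b hu .nil⟩
    rcases a with a | x | q
    · exact node (Sum.inl a) H
    · exact ⟨m, .refl, (unfolds_word_cons_iff x).2 ((unfolds_word_cons_iff x).1 H)⟩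
    · exact node (Sum.inr q) H

theorem Unfolds.reflTransGen [Finite Q] [∀ τ, Finite (σ τ)]
    (hM : ∀ τ, (M τ).accepts = τ.1.2.1) {k k' : VHedge (S ⊕ ((Σ τ, σ τ) ⊕ Q))}
    (hk : ReflTransGen (B.toCF2HA M).Step k k') {m : VHedge (S ⊕ Q)} (H : Unfolds M k m) :
    ∃ m', ReflTransGen B.Step m m' ∧ Unfolds M k' m' := by
  induction hk with
  | refl => exact ⟨m, .refl, H⟩
  | tail _ hs ih =>
    obtain ⟨m₁, hm₁, H₁⟩ := ih
    obtain ⟨m₂, hm₂, H₂⟩ := H₁.step hM hs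
    exact ⟨m₂, hm₁.trans hm₂, H₂⟩

theorem toCF2HA_stateLang [Finite Q] [∀ τ, Finite (σ τ)]
    (hM : ∀ τ, (M τ).accepts = τ.1.2.1) (q : Q) :
    (B.toCF2HA M).stateLang (Sum.inr q) = B.stateLang q := by
  ext h
  refine and_congr_right fun hh => ⟨fun H => ?_, fun H => ?_⟩
  · obtain ⟨m, hm, hu⟩ := (unfolds_hedgeMap_of_ground hh).reflTransGen hM H
    obtain ⟨ms, m', h₁, h₂, rfl⟩ := (unfolds_node_cons_iff (Sum.inr q)).1 hu
    obtain rfl := unfolds_nil_iff.1 h₁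
    obtain rfl := unfolds_nil_iff.1 h₂
    exact hm
  · have := H.trans_induction_on
      (motive := fun {k k'} _ => ReflTransGen (B.toCF2HA M).Step
        (hedgeMap embedLabel k) (hedgeMap embedLabel k'))
      (fun _ => .refl) (fun h => toCF2HA_simulates M hM h) (fun _ _ h h' => h.trans h')
    have embedLabel_inl :
        (embedLabel : S ⊕ Q → S ⊕ ((Σ τ, σ τ) ⊕ Q)) ∘ Sum.inl = Sum.inl := rfl
    rw [hedgeMap_hedgeMap_of_ground _ _ hh, embedLabel_inl] at this
    simpa [hedgeMap, VTree.map_node_s7, embedLabel] using this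

theorem toCF2HA_lang [Finite Q] [∀ τ, Finite (σ τ)]
    (hM : ∀ τ, (M τ).accepts = τ.1.2.1) : (B.toCF2HA M).lang = B.lang := by
  ext h
  simp [CF2HA.lang, lang, ← toCF2HA_stateLang hM, toCF2HA]

end Simulation

end WordHA

/-- Every HA language is a CF²HA language; moreover the CF²HA can be taken
with state set `Q = Q_h ⊎ Q_v` and only variable-free transitions of the forms
`ε → q_h`, `q_h · q_v → q'_h` and `a(q_h) → q_v`. -/
theorem cf2ha_of_ha {S Q : Type} [Finite S] [Finite Q]
    (B : WordHA S Q) (hB : B.IsHA) :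
    ∃ (Qh Qv : Type) (_ : Finite Qh) (_ : Finite Qv)
      (A : CF2HA S (Qh ⊕ Qv)),
      A.lang = B.lang ∧
      (∀ t ∈ A.hor,
        (t.1 = [] ∧ ∃ qh : Qh, t.2 = Sum.inl qh) ∨
        (∃ (qh : Qh) (qv : Qv) (qh' : Qh),
          t.1 = [(Sum.inr (Sum.inl qh), false), (Sum.inr (Sum.inr qv), false)] ∧
          t.2 = Sum.inl qh')) ∧
      (∀ v ∈ A.ver, ∃ (a : S) (qh : Qh) (qv : Qv),
        v = (Sum.inl a, Sum.inr (Sum.inl qh), false, Sum.inr qv)) := by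
  choose σ hσ M hM using fun τ : B.trans => hB τ.1 τ.2
  have := B.trans_fin.to_subtype
  refine ⟨Σ τ, σ τ, Q, inferInstance, inferInstance, B.toCF2HA M, WordHA.toCF2HA_lang hM, ?_, ?_⟩
  · rintro _ (⟨τ, rfl⟩ | ⟨⟨x, p⟩, rfl⟩)
    · exact Or.inl ⟨rfl, _, rfl⟩
    · exact Or.inr ⟨x, p, _, rfl, rfl⟩
  · rintro _ ⟨x, _, rfl⟩
    exact ⟨_, _, _, rfl⟩
end
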